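/- arXiv:1902.04847 — 2 statements merged into one kernel-verified Lean document; each statement's English description precedes it below -/
import Mathlib

section
/- Fix m ∈ ℤ/nℤ. If for every α ∈ ℤ/nℤ there exist integers s, t ≥ 0 such that 2^s α + t m = 0 in ℤ/nℤ, then there exists an integer N ≥ 0 such that c_m^N lies in the two-sided ideal (e₀) of A#C_n. -/
open scoped BigOperators

namespace NCIS

variable (k : Type*) [Field k] (n : ℕ)

/-- Relations defining the skew group algebra `A # C_n`, where
`A = k_{-1}[x_0, …, x_{n-1}]`: the generators are `x_i` (`Sum.inl i`) and `s` (`Sum.inr ()`),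
subject to `x_i x_j + x_j x_i = 0` for `i ≠ j`, `s^n = 1` and `s x_i = x_{i+1} s`. -/
inductive SGRel : FreeAlgebra k (ZMod n ⊕ Unit) → FreeAlgebra k (ZMod n ⊕ Unit) → Prop
  | anti (i j : ZMod n) (h : i ≠ j) :
      SGRel (FreeAlgebra.ι k (Sum.inl i) * FreeAlgebra.ι k (Sum.inl j)
           + FreeAlgebra.ι k (Sum.inl j) * FreeAlgebra.ι k (Sum.inl i)) 0
  | spow : SGRel (FreeAlgebra.ι k (Sum.inr ()) ^ n) 1
  | scomm (i : ZMod n) :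
      SGRel (FreeAlgebra.ι k (Sum.inr ()) * FreeAlgebra.ι k (Sum.inl i))
            (FreeAlgebra.ι k (Sum.inl (i + 1)) * FreeAlgebra.ι k (Sum.inr ()))

/-- The skew group algebra `A # C_n`. -/
abbrev SkewGroup := RingQuot (SGRel k n)

/-- The image of the generator `x_i` in `A # C_n`. -/
noncomputable def xg (i : ZMod n) : SkewGroup k n :=
  RingQuot.mkAlgHom k (SGRel k n) (FreeAlgebra.ι k (Sum.inl i))

/-- The image of the generator `s` in `A # C_n`. -/
noncomputable def sg : SkewGroup k n :=
  RingQuot.mkAlgHom k (SGRel k n) (FreeAlgebra.ι k (Sum.inr ()))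

/-- The integral `e₀ = (1/n) ∑_{i=0}^{n-1} s^i` in `A # C_n`. -/
noncomputable def e0 : SkewGroup k n := (n : k)⁻¹ • ∑ i ∈ Finset.range n, sg k n ^ i

/-- The quotient algebra `E = (A # C_n)/(e₀)` of `A # C_n` by the two-sided ideal
generated by `e₀`. -/
abbrev Equot := RingQuot (fun a b : SkewGroup k n => a = e0 k n ∧ b = 0)

end NCIS

namespace NCIS

variable (k : Type*) [Field k] (n : ℕ)

/-- The eigenvector `b_γ = (1/n) ∑_{i=0}^{n-1} ω^{iγ} x_i` in `A ⊆ A # C_n`. -/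
noncomputable def bg (ω : k) (γ : ZMod n) : SkewGroup k n :=
  (n : k)⁻¹ • ∑ i ∈ Finset.range n, ω ^ (i * γ.val) • xg k n (i : ZMod n)

/-- The central element `c_j = (2/n²) ∑_{i=0}^{n-1} ω^{ij} x_i²` of `A ⊆ A # C_n`. -/
noncomputable def cg (ω : k) (j : ZMod n) : SkewGroup k n :=
  (2 / (n : k) ^ 2) • ∑ i ∈ Finset.range n, ω ^ (i * j.val) • xg k n (i : ZMod n) ^ 2

/-- The idempotent `e_α = (1/n) ∑_{i=0}^{n-1} (ω^α s)^i` in `A # C_n`. -/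
noncomputable def eg (ω : k) (α : ZMod n) : SkewGroup k n :=
  (n : k)⁻¹ • ∑ i ∈ Finset.range n, (ω ^ α.val • sg k n) ^ i

end NCIS

namespace NCIS

section Character

variable {k : Type*} [Field k] {n : ℕ}

theorem pow_val_add [NeZero n] {ω : k} (hω : ω ^ n = 1) (a b : ZMod n) :
    ω ^ (a + b).val = ω ^ a.val * ω ^ b.val := by
  rw [ZMod.val_add, ← pow_add, ← pow_eq_pow_mod _ hω]

theorem pow_mul_val_eq_pow_val_natCast_mul [NeZero n] {ω : k} (hω : ω ^ n = 1) (i : ℕ)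
    (a : ZMod n) : ω ^ (i * a.val) = ω ^ ((i : ZMod n) * a).val := by
  rw [ZMod.val_mul, ZMod.val_natCast, ← pow_eq_pow_mod _ hω, pow_mul, pow_mul,
    ← pow_eq_pow_mod _ hω]

theorem sum_range_natCast_zmod [NeZero n] {M : Type*} [AddCommMonoid M] (f : ZMod n → M) :
    ∑ i ∈ Finset.range n, f (i : ZMod n) = ∑ a : ZMod n, f a := by
  refine Finset.sum_bij' (fun i _ => (i : ZMod n)) (fun a _ => a.val) ?_ ?_ ?_ ?_ ?_
  · simp
  · intro a _
    simpa using ZMod.val_lt a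
  · intro i hi
    exact ZMod.val_cast_of_lt (Finset.mem_range.mp hi)
  · simp
  · simp

end Character

variable (k : Type*) [Field k] (n : ℕ)

theorem xg_mul_xg_add (i j : ZMod n) (h : i ≠ j) :
    xg k n i * xg k n j + xg k n j * xg k n i = 0 := by
  simpa [xg] using RingQuot.mkAlgHom_rel k (SGRel.anti (k := k) i j h)

theorem sg_mul_xg (i : ZMod n) : sg k n * xg k n i = xg k n (i + 1) * sg k n := by
  simpa [xg, sg] using RingQuot.mkAlgHom_rel k (SGRel.scomm (k := k) i)

theorem commute_sq_of_mul_add_mul_eq_zero {R : Type*} [Ring R] {a b : R}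
    (h : a * b + b * a = 0) : Commute (a ^ 2) b := by
  have hanti : a * b = -(b * a) := eq_neg_of_add_eq_zero_left h
  rw [commute_iff_eq, sq, mul_assoc, hanti, mul_neg, ← mul_assoc, hanti, neg_mul, neg_neg,
    mul_assoc]

theorem commute_xg_sq_xg (i j : ZMod n) : Commute (xg k n i ^ 2) (xg k n j) := by
  by_cases h : i = j
  · subst h
    exact (Commute.refl _).pow_left 2
  · exact commute_sq_of_mul_add_mul_eq_zero (xg_mul_xg_add k n i j h)

theorem commute_cg_bg (ω : k) (m γ : ZMod n) : Commute (cg k n ω m) (bg k n ω γ) := by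
  refine Commute.smul_left (Commute.smul_right ?_ _) _
  refine Commute.sum_left _ _ _ fun i _ => Commute.sum_right _ _ _ fun j _ => ?_
  exact ((commute_xg_sq_xg k n _ _).smul_left _).smul_right _

theorem eg_zero (ω : k) : eg k n ω 0 = e0 k n := by
  simp [eg, e0]

/-- The vertex idempotent `e_α` multiplies some power of `c_m` into the ideal `(e₀)`. -/
def AnnihilatesPow (ω : k) (m α : ZMod n) : Prop :=
  ∃ N : ℕ, eg k n ω α * cg k n ω m ^ N ∈ TwoSidedIdeal.span {e0 k n}

theorem annihilatesPow_zero (ω : k) (m : ZMod n) : AnnihilatesPow k n ω m 0 :=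
  ⟨0, by
    rw [eg_zero, pow_zero, mul_one]
    exact TwoSidedIdeal.subset_span rfl⟩

variable {k n} [NeZero n]

theorem bg_eq_sum {ω : k} (hω : ω ^ n = 1) (γ : ZMod n) :
    bg k n ω γ = (n : k)⁻¹ • ∑ i : ZMod n, ω ^ (i * γ).val • xg k n i := by
  rw [bg, ← sum_range_natCast_zmod fun i : ZMod n => ω ^ (i * γ).val • xg k n i]
  simp only [pow_mul_val_eq_pow_val_natCast_mul hω]

theorem cg_eq_sum {ω : k} (hω : ω ^ n = 1) (m : ZMod n) :
    cg k n ω m = (2 / (n : k) ^ 2) • ∑ i : ZMod n, ω ^ (i * m).val • xg k n i ^ 2 := by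
  rw [cg, ← sum_range_natCast_zmod fun i : ZMod n => ω ^ (i * m).val • xg k n i ^ 2]
  simp only [pow_mul_val_eq_pow_val_natCast_mul hω]

theorem bg_mul_bg_add {ω : k} (hω : ω ^ n = 1) (γ δ : ZMod n) :
    bg k n ω γ * bg k n ω δ + bg k n ω δ * bg k n ω γ = cg k n ω (γ + δ) := by
  have expand : ∀ γ δ : ZMod n, bg k n ω γ * bg k n ω δ = ((n : k)⁻¹ * (n : k)⁻¹) •
      ∑ i : ZMod n, ∑ j : ZMod n, (ω ^ (i * γ).val * ω ^ (j * δ).val) •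
        (xg k n i * xg k n j) := by
    intro γ δ
    rw [bg_eq_sum hω, bg_eq_sum hω, smul_mul_smul_comm, Finset.sum_mul_sum]
    simp only [smul_mul_smul_comm]
  rw [expand γ δ, expand δ γ, Finset.sum_comm (γ := ZMod n) (f := fun i j =>
    (ω ^ (i * δ).val * ω ^ (j * γ).val) • (xg k n i * xg k n j)), ← smul_add,
    ← Finset.sum_add_distrib, cg_eq_sum hω]
  have diag : ∀ i : ZMod n, (∑ j : ZMod n, (ω ^ (i * γ).val * ω ^ (j * δ).val) •
        (xg k n i * xg k n j)) + ∑ j : ZMod n, (ω ^ (j * δ).val * ω ^ (i * γ).val) •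
        (xg k n j * xg k n i) = (2 : k) • ω ^ (i * (γ + δ)).val • xg k n i ^ 2 := by
    intro i
    rw [← Finset.sum_add_distrib, Finset.sum_eq_single i]
    · rw [mul_comm (ω ^ (i * δ).val), ← two_smul k, ← pow_val_add hω, ← mul_add, sq]
    · intro j _ hj
      rw [mul_comm (ω ^ (j * δ).val), ← smul_add, xg_mul_xg_add k n i j hj.symm, smul_zero]
    · simp
  simp only [diag]
  rw [← Finset.smul_sum, smul_smul]
  congr 1
  rw [div_eq_mul_inv, sq, mul_inv, mul_comm]

theorem semiconjBy_bg {ω : k} (hω : ω ^ n = 1) (α γ : ZMod n) :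
    SemiconjBy (bg k n ω γ) (ω ^ (α - γ).val • sg k n) (ω ^ α.val • sg k n) := by
  rw [SemiconjBy, bg_eq_sum hω]
  simp only [smul_mul_assoc, mul_smul_comm, Finset.sum_mul, Finset.mul_sum, Finset.smul_sum]
  rw [← Equiv.sum_comp (Equiv.addRight (1 : ZMod n))]
  refine Finset.sum_congr rfl fun i _ => ?_
  rw [sg_mul_xg]
  simp only [Equiv.coe_addRight, smul_smul]
  congr 1
  have hchar : ω ^ (α - γ).val * ω ^ ((i + 1) * γ).val = ω ^ α.val * ω ^ (i * γ).val := by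
    rw [← pow_val_add hω, ← pow_val_add hω]
    congr 2
    ring
  linear_combination (n : k)⁻¹ * hchar

theorem eg_mul_bg {ω : k} (hω : ω ^ n = 1) (α γ : ZMod n) :
    eg k n ω α * bg k n ω γ = bg k n ω γ * eg k n ω (α - γ) := by
  simp only [eg, smul_mul_assoc, mul_smul_comm, Finset.sum_mul, Finset.mul_sum]
  congr 1
  exact Finset.sum_congr rfl fun i _ => ((semiconjBy_bg hω α γ).pow_right i).eq.symm

theorem eg_mul_cg {ω : k} (hω : ω ^ n = 1) (α m : ZMod n) :
    eg k n ω α * cg k n ω m = cg k n ω m * eg k n ω (α - m) := by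
  have hc := bg_mul_bg_add hω m (0 : ZMod n)
  rw [add_zero] at hc
  rw [← hc, mul_add, add_mul, ← mul_assoc, ← mul_assoc, eg_mul_bg hω, eg_mul_bg hω, mul_assoc,
    mul_assoc, eg_mul_bg hω, eg_mul_bg hω, sub_zero, sub_zero, mul_assoc, mul_assoc]

theorem sum_eg [CharZero k] {ω : k} (hω : IsPrimitiveRoot ω n) :
    ∑ α : ZMod n, eg k n ω α = 1 := by
  simp only [eg, smul_pow]
  rw [← Finset.smul_sum, Finset.sum_comm]
  simp only [← Finset.sum_smul]
  have hsum : ∀ i ∈ Finset.range n,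
      ∑ α : ZMod n, (ω ^ α.val) ^ i = if i = 0 then (n : k) else 0 := by
    intro i hi
    rw [← sum_range_natCast_zmod fun α : ZMod n => (ω ^ α.val) ^ i]
    split_ifs with h0
    · simp [h0]
    · have hne : ω ^ i - 1 ≠ 0 :=
        sub_ne_zero.mpr (hω.pow_ne_one_of_pos_of_lt h0 (Finset.mem_range.mp hi))
      have hgeom := geom_sum_mul (ω ^ i) n
      rw [pow_right_comm, hω.pow_eq_one, one_pow, sub_self] at hgeom
      rw [← (mul_eq_zero.mp hgeom).resolve_right hne]
      refine Finset.sum_congr rfl fun j hj => ?_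
      rw [ZMod.val_cast_of_lt (Finset.mem_range.mp hj), pow_right_comm]
  rw [Finset.sum_congr rfl fun i hi => by rw [hsum i hi]]
  simp only [ite_smul, zero_smul, Finset.sum_ite_eq', Finset.mem_range, NeZero.pos n, if_true,
    pow_zero, smul_smul]
  rw [inv_mul_cancel₀ (NeZero.ne (n : k)), one_smul]

theorem AnnihilatesPow.of_sub {ω : k} (hω : ω ^ n = 1) {m α : ZMod n}
    (h : AnnihilatesPow k n ω m (α - m)) : AnnihilatesPow k n ω m α := by
  obtain ⟨N, hN⟩ := h
  refine ⟨N + 1, ?_⟩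
  rw [pow_succ', ← mul_assoc, eg_mul_cg hω, mul_assoc]
  exact TwoSidedIdeal.mul_mem_left _ _ _ hN

theorem AnnihilatesPow.of_sub_natCast_mul {ω : k} (hω : ω ^ n = 1) {m α : ZMod n} (t : ℕ)
    (h : AnnihilatesPow k n ω m (α - t * m)) : AnnihilatesPow k n ω m α := by
  induction t with
  | zero => simpa using h
  | succ t ih =>
    refine ih (AnnihilatesPow.of_sub hω ?_)
    convert h using 1
    push_cast
    ring

theorem AnnihilatesPow.of_add_natCast_mul {ω : k} (hω : ω ^ n = 1) {m α : ZMod n} (t : ℕ)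
    (h : AnnihilatesPow k n ω m (α + t * m)) : AnnihilatesPow k n ω m α := by
  refine AnnihilatesPow.of_sub_natCast_mul hω (-(t : ZMod n)).val ?_
  rwa [ZMod.natCast_zmod_val, neg_mul, sub_neg_eq_add]

theorem AnnihilatesPow.of_two_mul_sub {ω : k} (hω : ω ^ n = 1) {m α : ZMod n}
    (h : AnnihilatesPow k n ω m (2 * α - m)) : AnnihilatesPow k n ω m α := by
  obtain ⟨N, hN⟩ := h
  refine ⟨N + 1, ?_⟩
  have hc : cg k n ω m
      = bg k n ω α * bg k n ω (m - α) + bg k n ω (m - α) * bg k n ω α := by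
    rw [bg_mul_bg_add hω, add_sub_cancel]
  have hcomm := (commute_cg_bg k n ω m α).pow_left N
  have hsplit : eg k n ω α * cg k n ω m ^ (N + 1)
      = bg k n ω α * e0 k n * (bg k n ω (m - α) * cg k n ω m ^ N)
        + bg k n ω (m - α) * (eg k n ω (2 * α - m) * cg k n ω m ^ N) * bg k n ω α := by
    have hfirst : eg k n ω α * bg k n ω α = bg k n ω α * e0 k n := by
      rw [eg_mul_bg hω, sub_self, eg_zero]
    have hsecond : eg k n ω α * bg k n ω (m - α)
        = bg k n ω (m - α) * eg k n ω (2 * α - m) := by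
      rw [eg_mul_bg hω]
      congr 2
      ring
    calc eg k n ω α * cg k n ω m ^ (N + 1)
        = eg k n ω α * (bg k n ω α * bg k n ω (m - α) + bg k n ω (m - α) * bg k n ω α)
            * cg k n ω m ^ N := by rw [← hc, pow_succ', mul_assoc]
      _ = eg k n ω α * bg k n ω α * (bg k n ω (m - α) * cg k n ω m ^ N)
            + eg k n ω α * bg k n ω (m - α) * (bg k n ω α * cg k n ω m ^ N) := by
          simp only [mul_add, add_mul, mul_assoc]
      _ = _ := by
          rw [hfirst, hsecond, ← hcomm.eq]
          simp only [mul_assoc]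
  rw [hsplit]
  refine TwoSidedIdeal.add_mem _ ?_ ?_
  · exact TwoSidedIdeal.mul_mem_right _ _ _
      (TwoSidedIdeal.mul_mem_left _ _ _ (TwoSidedIdeal.subset_span rfl))
  · exact TwoSidedIdeal.mul_mem_right _ _ _ (TwoSidedIdeal.mul_mem_left _ _ _ hN)

theorem AnnihilatesPow.of_two_pow_mul {ω : k} (hω : ω ^ n = 1) {m : ZMod n} (s : ℕ)
    {α : ZMod n} (h : AnnihilatesPow k n ω m (2 ^ s * α)) : AnnihilatesPow k n ω m α := by
  induction s with
  | zero => simpa using h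
  | succ s ih =>
    refine ih (AnnihilatesPow.of_two_mul_sub hω (AnnihilatesPow.of_add_natCast_mul hω 1 ?_))
    convert h using 1
    push_cast
    ring

theorem exists_cg_pow_mem_of_annihilatesPow [CharZero k] {ω : k} (hω : IsPrimitiveRoot ω n)
    {m : ZMod n} (h : ∀ α, AnnihilatesPow k n ω m α) :
    ∃ N : ℕ, cg k n ω m ^ N ∈ TwoSidedIdeal.span {e0 k n} := by
  choose N hN using h
  refine ⟨∑ α, N α, ?_⟩
  rw [← one_mul (cg k n ω m ^ _), ← sum_eg hω, Finset.sum_mul]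
  refine sum_mem fun α _ => ?_
  rw [← Finset.add_sum_erase _ N (Finset.mem_univ α), pow_add, ← mul_assoc]
  exact TwoSidedIdeal.mul_mem_right _ _ _ (hN α)

end NCIS

open NCIS in
/-- Lemma 2.2: fix `m ∈ ℤ/n`.  If for every `α ∈ ℤ/n` there are
integers `s, t ≥ 0` with `2^s α + t m = 0` in `ℤ/n`, then some power of `c_m` lies in the
two-sided ideal `(e₀)` of `A#C_n`. -/
theorem c_pow_mem_ideal_e0_of_orbit
    (k : Type*) [Field k] [IsAlgClosed k] [CharZero k]
    (n : ℕ) (hn2 : 2 ≤ n) (ω : k) (hω : IsPrimitiveRoot ω n) (m : ZMod n)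
    (h : ∀ α : ZMod n, ∃ s t : ℕ, (2 : ZMod n) ^ s * α + (t : ZMod n) * m = 0) :
    ∃ N : ℕ, cg k n ω m ^ N ∈ TwoSidedIdeal.span {e0 k n} := by
  have : NeZero n := ⟨by omega⟩
  refine exists_cg_pow_mem_of_annihilatesPow hω fun α => ?_
  obtain ⟨s, t, hst⟩ := h α
  refine AnnihilatesPow.of_two_pow_mul hω.pow_eq_one s
    (AnnihilatesPow.of_add_natCast_mul hω.pow_eq_one t ?_)
  rw [hst]
  exact annihilatesPow_zero k n ω m
end

section
/- For every integer λ with gcd(λ, n) = 1 there exists a k-algebra automorphism f_λ of A satisfying f_λ(b_i) = b_{λi} for all i ∈ ℤ/nℤ (equivalently f_λ(x_i) = x_{ai} where a = λ^{−1} in ℤ/nℤ); moreover f_λ(R_j) = R_{λj} for all j, and consequently for each j there is a k-vector-space isomorphism A/R_j A ≅ A/R_{λj} A, where R_j A is the right ideal of A generated by R_j. -/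
open scoped BigOperators

namespace NCIS

variable (k : Type*) [Field k] (n : ℕ)

/-- Relations defining the `(-1)`-skew polynomial ring `A = k_{-1}[x_0, …, x_{n-1}]`:
`x_i x_j + x_j x_i = 0` for all `i ≠ j` in `ℤ/n`. -/
inductive ARel : FreeAlgebra k (ZMod n) → FreeAlgebra k (ZMod n) → Prop
  | anti (i j : ZMod n) (h : i ≠ j) :
      ARel (FreeAlgebra.ι k i * FreeAlgebra.ι k j + FreeAlgebra.ι k j * FreeAlgebra.ι k i) 0

/-- The `(-1)`-skew polynomial ring `A = k_{-1}[x_0, …, x_{n-1}]`. -/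
abbrev SkewPoly := RingQuot (ARel k n)

/-- The image of the generator `x_i` in `A`. -/
noncomputable def xA (i : ZMod n) : SkewPoly k n :=
  RingQuot.mkAlgHom k (ARel k n) (FreeAlgebra.ι k i)

/-- The eigenvector `b_γ = (1/n) ∑_{i=0}^{n-1} ω^{iγ} x_i ∈ A`. -/
noncomputable def bA (ω : k) (γ : ZMod n) : SkewPoly k n :=
  (n : k)⁻¹ • ∑ i ∈ Finset.range n, ω ^ (i * γ.val) • xA k n (i : ZMod n)

/-- The central element `c_j = (2/n²) ∑_{i=0}^{n-1} ω^{ij} x_i² ∈ A`. -/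
noncomputable def cA (ω : k) (j : ZMod n) : SkewPoly k n :=
  (2 / (n : k) ^ 2) • ∑ i ∈ Finset.range n, ω ^ (i * j.val) • xA k n (i : ZMod n) ^ 2

/-- The algebra automorphism `σ` of `A` determined by `σ(x_i) = x_{i+1}`, generating the
action of the cyclic group `C_n` on `A`. -/
noncomputable def sigmaA : SkewPoly k n →ₐ[k] SkewPoly k n :=
  RingQuot.liftAlgHom k
    ⟨(RingQuot.mkAlgHom k (ARel k n)).comp
        (FreeAlgebra.lift k (fun i : ZMod n => FreeAlgebra.ι k (i + 1))), by
      intro x y h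
      induction h with
      | anti i j hij =>
        have hne : i + 1 ≠ j + 1 := fun hc => hij (by exact add_left_injective 1 hc)
        have := RingQuot.mkAlgHom_rel k (ARel.anti (k := k) (n := n) (i + 1) (j + 1) hne)
        simpa using this⟩

/-- The `ω^{-j}`-eigenspace `R_j = {a ∈ A : σ·a = ω^{−j} a}` of the `C_n`-action on `A`. -/
def Rcomp (ω : k) (j : ZMod n) : Set (SkewPoly k n) :=
  {a : SkewPoly k n | sigmaA k n a = (ω ^ j.val)⁻¹ • a}

/-- The right ideal `R_j A` of `A` generated by `R_j`. -/
noncomputable def RcompA (ω : k) (j : ZMod n) : Submodule k (SkewPoly k n) :=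
  Submodule.span k {y : SkewPoly k n | ∃ r ∈ Rcomp k n ω j, ∃ a : SkewPoly k n, y = r * a}

end NCIS

namespace NCIS

section Permutation

variable (k : Type*) [Field k] (n : ℕ)

/-- Algebra homomorphisms out of `A` agreeing on the generators `x_i` are equal. -/
theorem skewPoly_hom_ext {B : Type*} [Semiring B] [Algebra k B] {f g : SkewPoly k n →ₐ[k] B}
    (h : ∀ i, f (xA k n i) = g (xA k n i)) : f = g := by
  apply RingQuot.ringQuot_ext'
  apply FreeAlgebra.hom_ext
  funext i
  exact h i

theorem sigmaA_xA (i : ZMod n) : sigmaA k n (xA k n i) = xA k n (i + 1) := by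
  simp [sigmaA, xA]

/-- The endomorphism of `A` sending `x_i` to `x_{e i}`, for an injection `e`. -/
noncomputable def reindexHom (e : ZMod n ↪ ZMod n) : SkewPoly k n →ₐ[k] SkewPoly k n :=
  RingQuot.liftAlgHom k ⟨FreeAlgebra.lift k (fun i => xA k n (e i)), by
    intro x y h
    induction h with
    | anti i j hij =>
      have := RingQuot.mkAlgHom_rel k
        (ARel.anti (k := k) (n := n) (e i) (e j) (e.injective.ne hij))
      simpa [xA] using this⟩

theorem reindexHom_xA (e : ZMod n ↪ ZMod n) (i : ZMod n) :
    reindexHom k n e (xA k n i) = xA k n (e i) := by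
  rw [xA, reindexHom, RingQuot.liftAlgHom_mkAlgHom_apply, FreeAlgebra.lift_ι_apply]

/-- The automorphism of `A` sending `x_i` to `x_{e i}`, for a permutation `e`. -/
noncomputable def reindexEquiv (e : Equiv.Perm (ZMod n)) : SkewPoly k n ≃ₐ[k] SkewPoly k n :=
  AlgEquiv.ofAlgHom (reindexHom k n e.toEmbedding) (reindexHom k n e.symm.toEmbedding)
    (skewPoly_hom_ext k n fun i => by simp [reindexHom_xA])
    (skewPoly_hom_ext k n fun i => by simp [reindexHom_xA])

theorem reindexEquiv_xA (e : Equiv.Perm (ZMod n)) (i : ZMod n) :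
    reindexEquiv k n e (xA k n i) = xA k n (e i) :=
  reindexHom_xA k n e.toEmbedding i

theorem reindexEquiv_symm (e : Equiv.Perm (ZMod n)) :
    (reindexEquiv k n e).symm = reindexEquiv k n e.symm := rfl

/-- The automorphism `f_u` of `A` sending `x_i` to `x_{u⁻¹ i}`, for a unit `u` of `ℤ/n`. -/
noncomputable def unitEquiv (u : (ZMod n)ˣ) : SkewPoly k n ≃ₐ[k] SkewPoly k n :=
  reindexEquiv k n (Units.mulLeft u⁻¹)

theorem unitEquiv_xA (u : (ZMod n)ˣ) (i : ZMod n) :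
    unitEquiv k n u (xA k n i) = xA k n ((u⁻¹ : (ZMod n)ˣ) * i) :=
  reindexEquiv_xA k n _ i

theorem unitEquiv_symm (u : (ZMod n)ˣ) : (unitEquiv k n u).symm = unitEquiv k n u⁻¹ := by
  rw [unitEquiv, reindexEquiv_symm, unitEquiv, Units.mulLeft_symm]

theorem sigmaA_pow_xA (m : ℕ) (i : ZMod n) :
    (sigmaA k n ^ m) (xA k n i) = xA k n (i + m) := by
  induction m with
  | zero => simp
  | succ m ih => rw [pow_succ', AlgHom.mul_apply, ih, sigmaA_xA, Nat.cast_succ, add_assoc]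

/-- The commutation rule `σ f_u = f_u σ^u`. -/
theorem sigmaA_unitEquiv [NeZero n] (u : (ZMod n)ˣ) (a : SkewPoly k n) :
    sigmaA k n (unitEquiv k n u a) =
      unitEquiv k n u ((sigmaA k n ^ (u : ZMod n).val) a) := by
  have h : (sigmaA k n).comp (unitEquiv k n u : SkewPoly k n →ₐ[k] SkewPoly k n) =
      (unitEquiv k n u : SkewPoly k n →ₐ[k] SkewPoly k n).comp
        (sigmaA k n ^ (u : ZMod n).val) :=
    skewPoly_hom_ext k n fun i => by
      rw [AlgHom.comp_apply, AlgHom.comp_apply, sigmaA_pow_xA]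
      simp [unitEquiv_xA, sigmaA_xA, mul_add]
  exact DFunLike.congr_fun h a

variable {k n}

theorem sigmaA_pow_apply_of_mem_Rcomp {ω : k} {j : ZMod n} {a : SkewPoly k n}
    (ha : a ∈ Rcomp k n ω j) (m : ℕ) :
    (sigmaA k n ^ m) a = ((ω ^ j.val)⁻¹) ^ m • a := by
  have ha' : sigmaA k n a = (ω ^ j.val)⁻¹ • a := ha
  induction m with
  | zero => simp
  | succ m ih => rw [pow_succ', AlgHom.mul_apply, ih, map_smul, ha', smul_smul, ← pow_succ]

/-- Powers of an `n`-th root of unity depend only on the exponent modulo `n`. -/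
theorem pow_eq_pow_of_natCast_eq {ω : k} (hω : ω ^ n = 1) {a b : ℕ}
    (h : (a : ZMod n) = b) : ω ^ a = ω ^ b :=
  pow_eq_pow_of_modEq ((ZMod.natCast_eq_natCast_iff a b n).1 h) hω

theorem unitEquiv_mem_Rcomp [NeZero n] {ω : k} (hω : ω ^ n = 1) (u : (ZMod n)ˣ) {j : ZMod n}
    {a : SkewPoly k n} (ha : a ∈ Rcomp k n ω j) :
    unitEquiv k n u a ∈ Rcomp k n ω (u * j) := by
  change sigmaA k n (unitEquiv k n u a) = _
  rw [sigmaA_unitEquiv, sigmaA_pow_apply_of_mem_Rcomp ha, map_smul, inv_pow, ← pow_mul,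
    pow_eq_pow_of_natCast_eq hω (b := ((u : ZMod n) * j).val)]
  simp [mul_comm]

theorem unitEquiv_image_Rcomp [NeZero n] {ω : k} (hω : ω ^ n = 1) (u : (ZMod n)ˣ)
    (j : ZMod n) : unitEquiv k n u '' Rcomp k n ω j = Rcomp k n ω (u * j) := by
  apply Set.Subset.antisymm
  · rintro _ ⟨a, ha, rfl⟩
    exact unitEquiv_mem_Rcomp hω u ha
  · intro a ha
    refine ⟨(unitEquiv k n u).symm a, ?_, AlgEquiv.apply_symm_apply _ a⟩
    rw [unitEquiv_symm]
    simpa using unitEquiv_mem_Rcomp hω u⁻¹ ha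

theorem bA_eq_sum_zmod [NeZero n] (ω : k) (hω : ω ^ n = 1) (γ : ZMod n) :
    bA k n ω γ = (n : k)⁻¹ • ∑ i : ZMod n, ω ^ (i * γ).val • xA k n i := by
  rw [bA]
  congr 1
  refine Finset.sum_bij' (fun i _ => (i : ZMod n)) (fun i _ => i.val) ?_ ?_ ?_ ?_ ?_
  · simp
  · simp [ZMod.val_lt]
  · intro i hi
    exact ZMod.val_cast_of_lt (Finset.mem_range.1 hi)
  · simp
  · intro i _
    rw [pow_eq_pow_of_natCast_eq hω (b := ((i : ZMod n) * γ).val)]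
    simp

theorem unitEquiv_bA [NeZero n] {ω : k} (hω : ω ^ n = 1) (u : (ZMod n)ˣ) (γ : ZMod n) :
    unitEquiv k n u (bA k n ω γ) = bA k n ω (u * γ) := by
  rw [bA_eq_sum_zmod ω hω, bA_eq_sum_zmod ω hω, map_smul, map_sum]
  congr 1
  refine Fintype.sum_equiv (Units.mulLeft u⁻¹) _ _ fun i => ?_
  rw [map_smul, unitEquiv_xA, Units.mulLeft_apply]
  congr 3
  rw [mul_mul_mul_comm, Units.inv_mul, one_mul]

/-- An automorphism mapping `R_i` onto `R_j` maps the right ideal `R_i A` onto `R_j A`. -/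
theorem map_RcompA {ω : k} {i j : ZMod n} (f : SkewPoly k n ≃ₐ[k] SkewPoly k n)
    (hf : f '' Rcomp k n ω i = Rcomp k n ω j) :
    (RcompA k n ω i).map (f.toLinearEquiv : SkewPoly k n →ₗ[k] SkewPoly k n) =
      RcompA k n ω j := by
  rw [RcompA, RcompA, Submodule.map_span, ← hf]
  congr 1
  ext y
  constructor
  · rintro ⟨_, ⟨r, hr, a, rfl⟩, rfl⟩
    exact ⟨f r, Set.mem_image_of_mem f hr, f a, map_mul f r a⟩
  · rintro ⟨_, ⟨r, hr, rfl⟩, a, rfl⟩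
    refine ⟨r * f.symm a, ⟨r, hr, _, rfl⟩, ?_⟩
    simp

end Permutation

end NCIS

open NCIS in
/-- Definition 3.3 and Lemma 3.4: for every integer `λ` coprime to `n`
there is a `k`-algebra automorphism `f_λ` of `A` with `f_λ(b_i) = b_{λi}` for all `i`;
it satisfies `f_λ(R_j) = R_{λj}`, and consequently `A/R_jA ≅ A/R_{λj}A` as `k`-vector
spaces. -/
theorem exists_algEquiv_b_mul
    (k : Type*) [Field k] [IsAlgClosed k] [CharZero k]
    (n : ℕ) (hn2 : 2 ≤ n) (ω : k) (hω : IsPrimitiveRoot ω n)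
    (lam : ℤ) (hlam : Int.gcd lam (n : ℤ) = 1) :
    ∃ f : SkewPoly k n ≃ₐ[k] SkewPoly k n,
      (∀ i : ZMod n, f (bA k n ω i) = bA k n ω ((lam : ZMod n) * i)) ∧
      (∀ j : ZMod n, ⇑f '' Rcomp k n ω j = Rcomp k n ω ((lam : ZMod n) * j)) ∧
      (∀ j : ZMod n,
        Nonempty ((SkewPoly k n ⧸ RcompA k n ω j) ≃ₗ[k]
          (SkewPoly k n ⧸ RcompA k n ω ((lam : ZMod n) * j)))) := by
  have : NeZero n := ⟨by omega⟩
  obtain ⟨u, hu⟩ : IsUnit (lam : ZMod n) :=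
    (ZMod.coe_int_isUnit_iff_isCoprime lam n).2 (Int.isCoprime_iff_gcd_eq_one.2 hlam).symm
  rw [← hu]
  have hR := unitEquiv_image_Rcomp hω.pow_eq_one u
  exact ⟨unitEquiv k n u, unitEquiv_bA hω.pow_eq_one u, hR, fun j =>
    ⟨Submodule.Quotient.equiv _ _ (unitEquiv k n u).toLinearEquiv (map_RcompA _ (hR j))⟩⟩
end
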